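/- arXiv:1302.0336 — 3 statements merged into one kernel-verified Lean document; each statement's English description precedes it below -/
import Mathlib

section
/- (Gilardoni, symmetric case) Let f:(0,∞)→ℝ be convex with f(1)=0 and symmetric in the sense that f(x) = x f(1/x) for all x ∈ (0,∞). Let B(V) := inf{D_f(P‖Q) : V(P,Q) ≥ V} over all pairs of probability measures on all measurable spaces. Then for every 0 ≤ V ≤ 1, B(V) = (1−V) f((1+V)/(1−V)). Consequently, for every pair of probability measures P, Q, D_f(P‖Q) ≥ (1 − V(P,Q)) f((1 + V(P,Q))/(1 − V(P,Q))), and this is the sharpest possible inequality between the symmetric divergence D_f and the total variation distance. -/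
open MeasureTheory Filter Set
open scoped ENNReal NNReal Classical

noncomputable section

/-- The limit of `f` at `0` from the right, as an extended real number
(for `f` convex on `(0,∞)` the `limsup` below is the actual limit). -/
def limAtZero (f : ℝ → ℝ) : EReal :=
  Filter.limsup (fun x => (f x : EReal)) (nhdsWithin 0 (Set.Ioi 0))

/-- The limit of `f x / x` as `x → ∞`, as an extended real number
(for `f` convex on `(0,∞)` the `limsup` below is the actual limit). -/
def derivAtTop (f : ℝ → ℝ) : EReal :=
  Filter.limsup (fun x => ((f x / x : ℝ) : EReal)) Filter.atTop

/-- The `f`-divergence `D_f(P‖Q) = ∫_{q>0} f(p/q) dQ + f'(∞) P{q = 0}`, where the part of the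
integral over `{p = 0, q > 0}` is interpreted via the limit `f(0) := lim_{x↓0} f x`, and the part
over `{q = 0}` (the `Q`-singular part of `P`) via `f'(∞) := lim_{x→∞} f x / x`. -/
def fDiv (f : ℝ → ℝ) {Ω : Type*} [MeasurableSpace Ω] (P Q : Measure Ω) : EReal :=
  (if Integrable (fun x => f ((Measure.rnDeriv P Q x).toReal))
      (Q.restrict {x | Measure.rnDeriv P Q x ≠ 0})
   then ((∫ x in {x | Measure.rnDeriv P Q x ≠ 0},
       f ((Measure.rnDeriv P Q x).toReal) ∂Q : ℝ) : EReal)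
   else (⊤ : EReal))
  + limAtZero f * ((Q {x | Measure.rnDeriv P Q x = 0} : ℝ≥0∞) : EReal)
  + derivAtTop f * ((Measure.singularPart P Q Set.univ : ℝ≥0∞) : EReal)

/-- A pair of probability measures on an arbitrary measurable space. -/
structure PMPair where
  carrier : Type
  inst : MeasurableSpace carrier
  P : @Measure carrier inst
  Q : @Measure carrier inst
  probP : @IsProbabilityMeasure carrier inst P
  probQ : @IsProbabilityMeasure carrier inst Q

attribute [instance] PMPair.inst

/-- The total variation distance `V(P,Q) = (1/2) ∫ |p - q| dλ` (with `λ = P + Q`). -/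
def tvDist {Ω : Type*} [MeasurableSpace Ω] (P Q : Measure Ω) : ℝ :=
  (∫ x, |(Measure.rnDeriv P (P + Q) x).toReal - (Measure.rnDeriv Q (P + Q) x).toReal|
    ∂(P + Q)) / 2

/-- The function `ψ_{P,Q}(s) = ∫ min (p, q s) dλ` (with `λ = P + Q`). -/
def psiPQ {Ω : Type*} [MeasurableSpace Ω] (P Q : Measure Ω) (s : ℝ) : ℝ :=
  ∫ x, min ((Measure.rnDeriv P (P + Q) x).toReal)
    ((Measure.rnDeriv Q (P + Q) x).toReal * s) ∂(P + Q)

/-- The right derivative of `f`. -/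
def rightDeriv (f : ℝ → ℝ) (x : ℝ) : ℝ := derivWithin f (Set.Ioi x) x

/-- `ν` is the measure `ν_f` on `(0,∞)` with `ν (a,b] = ∂⁺f(b) - ∂⁺f(a)`. -/
def IsCurvatureMeasure (f : ℝ → ℝ) (ν : Measure ℝ) : Prop :=
  ∀ a b : ℝ, 0 < a → a ≤ b →
    ν (Set.Ioc a b) = ENNReal.ofReal (rightDeriv f b - rightDeriv f a)

/-- The functional `I_f(ψ) = ∫_{(0,∞)} (min(1,s) - ψ(s)) dν_f(s)`. -/
def Ifun (ν : Measure ℝ) (ψ : ℝ → ℝ) : ℝ≥0∞ :=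
  ∫⁻ s in Set.Ioi (0 : ℝ), ENNReal.ofReal (min 1 s - ψ s) ∂ν

/-- The class `C` of functions on `[0,∞)` (encoded as functions on `ℝ` vanishing on `(-∞,0)`)
that are nonnegative, concave, nondecreasing and bounded by `min(1,s)` on `[0,∞)`. -/
def Cclass : Set (ℝ → ℝ) :=
  {ψ | (∀ s, 0 ≤ s → 0 ≤ ψ s) ∧ ConcaveOn ℝ (Set.Ici 0) ψ ∧ MonotoneOn ψ (Set.Ici 0) ∧
    (∀ s, 0 ≤ s → ψ s ≤ min 1 s) ∧ ∀ s, s < 0 → ψ s = 0}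

/-- The sharp lower bound `(1-V) f((1+V)/(1-V))` for a symmetric `f`-divergence in terms of the
total variation distance, interpreted as `f(0) + f'(∞)` at `V = 1`. -/
def gilBound (f : ℝ → ℝ) (V : ℝ) : EReal :=
  if V < 1 then (((1 - V) * f ((1 + V) / (1 - V)) : ℝ) : EReal)
  else limAtZero f + derivAtTop f

lemma gs_nonneg {f : ℝ → ℝ}
    (hf : ConvexOn ℝ (Set.Ioi 0) f) (hf1 : f 1 = 0)
    (hsymm : ∀ x : ℝ, 0 < x → f x = x * f (1 / x)) {x : ℝ} (hx : 0 < x) : 0 ≤ f x := by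
  have hy : 1 / x ∈ Set.Ioi (0 : ℝ) := by simpa using hx
  have h := hf.2 (Set.mem_Ioi.2 hx) hy (show 0 ≤ 1 / (1 + x) by positivity)
    (show 0 ≤ x / (1 + x) by positivity) (by field_simp)
  have e : (1 / (1 + x)) • x + (x / (1 + x)) • (1 / x) = (1 : ℝ) := by
    simp only [smul_eq_mul]; field_simp; ring
  rw [e, hf1] at h
  have h2 : (1 / (1 + x)) • f x + (x / (1 + x)) • f (1 / x) = 2 / (1 + x) * f x := by
    simp only [smul_eq_mul]
    have := hsymm x hx
    rw [div_mul_eq_mul_div x, ← this]; ring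
  rw [h2] at h
  have h3 : 0 < 2 / (1 + x) := by positivity
  exact nonneg_of_mul_nonneg_right h h3

lemma gs_support {f : ℝ → ℝ}
    (hf : ConvexOn ℝ (Set.Ioi 0) f) {x₀ : ℝ} (hx : 0 < x₀) :
    ∃ a : ℝ, ∀ x, 0 < x → f x₀ + a * (x - x₀) ≤ f x := by
  have hi : x₀ ∈ interior (Set.Ioi (0:ℝ)) := by simpa using hx
  refine ⟨derivWithin f (Set.Ioi x₀) x₀, fun x hx0 => ?_⟩
  rcases lt_trichotomy x x₀ with h | h | h
  · have h1 := hf.slope_le_leftDeriv_of_mem_interior hx0 hi h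
    have h2 := hf.leftDeriv_le_rightDeriv_of_mem_interior hi
    have h3 := h1.trans h2
    rw [slope_def_field, div_le_iff₀ (by linarith)] at h3
    linarith
  · subst h; simp
  · have h1 := hf.rightDeriv_le_slope_of_mem_interior hi (y := x) hx0 h
    rw [slope_def_field, le_div_iff₀ (by linarith)] at h1
    linarith

/-- The supporting line, in symmetrized form. -/
lemma gs_line {f : ℝ → ℝ}
    (hf : ConvexOn ℝ (Set.Ioi 0) f) (hf1 : f 1 = 0)
    (hsymm : ∀ x : ℝ, 0 < x → f x = x * f (1 / x)) {V : ℝ} (h0 : 0 ≤ V) (h1 : V < 1) :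
    ∃ a b : ℝ, b ≤ a ∧ (∀ x, 0 < x → a * x + b ≤ f x) ∧ (∀ x, 0 < x → a + b * x ≤ f x) ∧
      (1 - V) * f ((1 + V) / (1 - V)) = a * (1 + V) + b * (1 - V) := by
  rcases h0.eq_or_lt with h | h
  · subst h
    exact ⟨0, 0, le_rfl, fun x hx => by simpa using gs_nonneg hf hf1 hsymm hx,
      fun x hx => by simpa using gs_nonneg hf hf1 hsymm hx, by simp [hf1]⟩
  · have hV : 0 < 1 - V := by linarith
    set x₀ := (1 + V) / (1 - V) with hx₀
    have hxp : 1 < x₀ := by rw [hx₀, lt_div_iff₀ hV]; linarith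
    have hxpos : 0 < x₀ := by linarith
    obtain ⟨a, ha⟩ := gs_support hf hxpos
    have hA : ∀ x, 0 < x → a * x + (f x₀ - a * x₀) ≤ f x := fun x hx => by
      have := ha x hx; linarith
    have hB : ∀ x, 0 < x → a + (f x₀ - a * x₀) * x ≤ f x := fun x hx => by
      have h2 := hA (1 / x) (by positivity)
      have h3 := mul_le_mul_of_nonneg_left h2 hx.le
      rw [← hsymm x hx] at h3
      refine le_trans (le_of_eq ?_) h3
      field_simp
    refine ⟨a, f x₀ - a * x₀, ?_, hA, hB, ?_⟩
    · have h2 := hB x₀ hxpos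
      nlinarith
    · have : (1 - V) * x₀ = 1 + V := by rw [hx₀]; field_simp
      linear_combination a * this

lemma gs_le_limAtZero {f : ℝ → ℝ} {a b : ℝ} (h : ∀ x, 0 < x → a + b * x ≤ f x) :
    (a : EReal) ≤ limAtZero f := by
  have ht : Tendsto (fun x : ℝ => ((a + b * x : ℝ) : EReal)) (nhdsWithin 0 (Set.Ioi 0))
      (nhds (a : EReal)) := by
    refine (continuous_coe_real_ereal.tendsto _).comp ?_
    have : Tendsto (fun x : ℝ => a + b * x) (nhds 0) (nhds (a + b * 0)) :=
      Continuous.tendsto (by fun_prop) _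
    simpa using this.mono_left nhdsWithin_le_nhds
  rw [← ht.limsup_eq]
  refine limsup_le_limsup ?_
  filter_upwards [self_mem_nhdsWithin] with x hx
  exact EReal.coe_le_coe_iff.2 (h x hx)

lemma gs_le_derivAtTop {f : ℝ → ℝ} {a b : ℝ} (h : ∀ x, 0 < x → a * x + b ≤ f x) :
    (a : EReal) ≤ derivAtTop f := by
  have ht : Tendsto (fun x : ℝ => ((a + b * x⁻¹ : ℝ) : EReal)) atTop
      (nhds (a : EReal)) := by
    refine (continuous_coe_real_ereal.tendsto _).comp ?_
    have : Tendsto (fun x : ℝ => a + b * x⁻¹) atTop (nhds (a + b * 0)) :=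
      tendsto_const_nhds.add (tendsto_const_nhds.mul tendsto_inv_atTop_zero)
    simpa using this
  rw [← ht.limsup_eq]
  refine limsup_le_limsup ?_
  filter_upwards [eventually_gt_atTop 0] with x hx
  refine EReal.coe_le_coe_iff.2 ?_
  rw [le_div_iff₀ hx]
  refine le_trans (le_of_eq ?_) (h x hx)
  field_simp

section meas
variable {Ω : Type*} [MeasurableSpace Ω] (P Q : Measure Ω)
  [IsProbabilityMeasure P] [IsProbabilityMeasure Q]

lemma gs_int_min : Integrable (fun x => min (P.rnDeriv Q x).toReal 1) Q :=
  Measure.integrable_toReal_rnDeriv.inf (integrable_const _)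

lemma gs_int_max : Integrable (fun x => max (P.rnDeriv Q x).toReal 1) Q :=
  Measure.integrable_toReal_rnDeriv.sup (integrable_const _)

lemma gs_tv : tvDist P Q = 1 - ∫ x, min (P.rnDeriv Q x).toReal 1 ∂Q := by
  have hQ : Q ≪ P + Q := Measure.absolutelyContinuous_of_le (Measure.le_add_left le_rfl)
  have hP : P ≪ P + Q := Measure.absolutelyContinuous_of_le (Measure.le_add_right le_rfl)
  have e1 := Measure.ae_rnDeriv_ne_zero_imp_of_ae (P + Q)
    (Measure.rnDeriv_mul_rnDeriv' (μ := P) hQ)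
  have e2 : (fun x => |(P.rnDeriv (P + Q) x).toReal - (Q.rnDeriv (P + Q) x).toReal|)
      =ᵐ[P + Q] fun x => (P.rnDeriv (P + Q) x).toReal + (Q.rnDeriv (P + Q) x).toReal
        - 2 * ((Q.rnDeriv (P + Q) x).toReal * min (P.rnDeriv Q x).toReal 1) := by
    filter_upwards [e1] with x hx
    have key : min (P.rnDeriv (P + Q) x).toReal (Q.rnDeriv (P + Q) x).toReal =
        (Q.rnDeriv (P + Q) x).toReal * min (P.rnDeriv Q x).toReal 1 := by
      by_cases h : Q.rnDeriv (P + Q) x = 0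
      · simp [h]
      · have := hx h
        rw [← this, Pi.mul_apply, ENNReal.toReal_mul, mul_min_of_nonneg _ _ ENNReal.toReal_nonneg,
          mul_one, mul_comm]
    rw [← key]
    rcases le_total (P.rnDeriv (P + Q) x).toReal (Q.rnDeriv (P + Q) x).toReal with h | h
    · rw [min_eq_left h, abs_of_nonpos (by linarith)]; ring
    · rw [min_eq_right h, abs_of_nonneg (by linarith)]; ring
  have hi : Integrable (fun x => (Q.rnDeriv (P + Q) x).toReal * min (P.rnDeriv Q x).toReal 1)
      (P + Q) := (integrable_toReal_rnDeriv_mul_iff hQ).2 (gs_int_min P Q)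
  unfold tvDist
  have hpq : Integrable (fun x => (P.rnDeriv (P + Q) x).toReal + (Q.rnDeriv (P + Q) x).toReal)
      (P + Q) := Measure.integrable_toReal_rnDeriv.add Measure.integrable_toReal_rnDeriv
  rw [integral_congr_ae e2, integral_sub
    hpq (hi.const_mul 2),
    integral_add Measure.integrable_toReal_rnDeriv Measure.integrable_toReal_rnDeriv,
    integral_const_mul, integral_toReal_rnDeriv_mul hQ, Measure.integral_toReal_rnDeriv hP,
    Measure.integral_toReal_rnDeriv hQ]
  simp
  ring

lemma gs_tv_nonneg : 0 ≤ tvDist P Q := by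
  unfold tvDist
  have : 0 ≤ ∫ x, |(Measure.rnDeriv P (P + Q) x).toReal - (Measure.rnDeriv Q (P + Q) x).toReal|
    ∂(P + Q) := integral_nonneg fun x => abs_nonneg _
  linarith

lemma gs_tv_le_one : tvDist P Q ≤ 1 := by
  rw [gs_tv]
  have : 0 ≤ ∫ x, min (P.rnDeriv Q x).toReal 1 ∂Q :=
    integral_nonneg fun x => le_min ENNReal.toReal_nonneg zero_le_one
  linarith

lemma gs_mass : ∫ x, (P.rnDeriv Q x).toReal ∂Q + (P.singularPart Q).real univ = 1 := by
  rw [Measure.integral_toReal_rnDeriv']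
  simp

lemma gs_max : ∫ x, max (P.rnDeriv Q x).toReal 1 ∂Q + (P.singularPart Q).real univ =
    1 + tvDist P Q := by
  have h : ∫ x, max (P.rnDeriv Q x).toReal 1 ∂Q + ∫ x, min (P.rnDeriv Q x).toReal 1 ∂Q =
      ∫ x, (P.rnDeriv Q x).toReal ∂Q + 1 := by
    rw [← integral_add (gs_int_max P Q) (gs_int_min P Q)]
    simp_rw [max_add_min]
    rw [integral_add Measure.integrable_toReal_rnDeriv (integrable_const _)]
    simp
  have := gs_mass P Q
  rw [gs_tv]
  linarith

lemma gs_lower {f : ℝ → ℝ}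
    (hf : ConvexOn ℝ (Set.Ioi 0) f) (hf1 : f 1 = 0)
    (hsymm : ∀ x : ℝ, 0 < x → f x = x * f (1 / x)) {V : ℝ} (h0 : 0 ≤ V) (h1 : V < 1)
    (hV : V ≤ tvDist P Q) :
    (((1 - V) * f ((1 + V) / (1 - V)) : ℝ) : EReal) ≤ fDiv f P Q := by
  obtain ⟨a, b, hba, hA, hB, hE⟩ := gs_line hf hf1 hsymm h0 h1
  have hL0 : (0 : EReal) ≤ limAtZero f := by
    have := gs_le_limAtZero (f := f) (a := 0) (b := 0)
      (fun x hx => by simpa using gs_nonneg hf hf1 hsymm hx)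
    simpa using this
  have hD0 : (0 : EReal) ≤ derivAtTop f := by
    have := gs_le_derivAtTop (f := f) (a := 0) (b := 0)
      (fun x hx => by simpa using gs_nonneg hf hf1 hsymm hx)
    simpa using this
  have hL := gs_le_limAtZero hB
  have hD := gs_le_derivAtTop hA
  have cz : ∀ z : ℝ≥0∞, (0 : EReal) ≤ (z : EReal) := fun z => EReal.coe_ennreal_nonneg z
  unfold fDiv
  set S : Set Ω := {x | P.rnDeriv Q x ≠ 0} with hS
  set T : Set Ω := {x | P.rnDeriv Q x = 0} with hT
  have hTm : MeasurableSet T := Measure.measurable_rnDeriv P Q (measurableSet_singleton 0)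
  have hST : S = Tᶜ := rfl
  have hSm : MeasurableSet S := hTm.compl
  split_ifs with hint
  · have t2 : ((a * Q.real T : ℝ) : EReal) ≤ limAtZero f * ((Q T : ℝ≥0∞) : EReal) := by
      rw [EReal.coe_mul, Measure.real, EReal.coe_ennreal_toReal (measure_ne_top _ _)]
      exact mul_le_mul_of_nonneg_right hL (cz _)
    have t3 : ((a * (P.singularPart Q).real univ : ℝ) : EReal) ≤
        derivAtTop f * ((P.singularPart Q univ : ℝ≥0∞) : EReal) := by
      rw [EReal.coe_mul, Measure.real, EReal.coe_ennreal_toReal (measure_ne_top _ _)]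
      exact mul_le_mul_of_nonneg_right hD (cz _)
    have t1 : ∫ x in S, (a * max (P.rnDeriv Q x).toReal 1 + b * min (P.rnDeriv Q x).toReal 1) ∂Q
        ≤ ∫ x in S, f (P.rnDeriv Q x).toReal ∂Q := by
      refine setIntegral_mono_ae_restrict
        (((gs_int_max P Q).const_mul a).add ((gs_int_min P Q).const_mul b)).integrableOn hint ?_
      filter_upwards [ae_restrict_mem hSm, ae_restrict_of_ae (Measure.rnDeriv_lt_top P Q)]
        with x hx hx2
      have hpos : 0 < (P.rnDeriv Q x).toReal := ENNReal.toReal_pos hx hx2.ne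
      rcases le_total (P.rnDeriv Q x).toReal 1 with h | h
      · simp only [max_eq_right h, min_eq_left h, mul_one]; exact hB _ hpos
      · simp only [max_eq_left h, min_eq_right h, mul_one]; exact hA _ hpos
    have t4 : ∫ x in T, (a * max (P.rnDeriv Q x).toReal 1 + b * min (P.rnDeriv Q x).toReal 1) ∂Q
        = a * Q.real T := by
      rw [setIntegral_congr_fun (g := fun _ => a) hTm]
      · simp [mul_comm]
      · intro x hx
        have : P.rnDeriv Q x = 0 := hx
        simp [this]
    have t5 := integral_add_compl hTm
      (((gs_int_max P Q).const_mul a).add ((gs_int_min P Q).const_mul b))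
    simp only [Pi.add_apply] at t5
    rw [t4, ← hST, integral_add ((gs_int_max P Q).const_mul a) ((gs_int_min P Q).const_mul b),
      integral_const_mul, integral_const_mul] at t5
    have hM := gs_max P Q
    have hm := gs_tv P Q
    have fin : (1 - V) * f ((1 + V) / (1 - V)) ≤ ∫ x in S, f (P.rnDeriv Q x).toReal ∂Q
        + a * Q.real T + a * (P.singularPart Q).real univ := by
      rw [hE]
      have e1 : ∫ x, max (P.rnDeriv Q x).toReal 1 ∂Q =
        1 + tvDist P Q - (P.singularPart Q).real univ := by linarith
      have e2 : ∫ x, min (P.rnDeriv Q x).toReal 1 ∂Q = 1 - tvDist P Q := by linarith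
      rw [e1, e2] at t5
      nlinarith
    refine (EReal.coe_le_coe_iff.2 fin).trans ?_
    rw [EReal.coe_add, EReal.coe_add]
    exact add_le_add (add_le_add le_rfl t2) t3
  · have t2 : (0 : EReal) ≤ limAtZero f * ((Q T : ℝ≥0∞) : EReal) := mul_nonneg hL0 (cz _)
    have t3 : (0 : EReal) ≤ derivAtTop f * ((P.singularPart Q univ : ℝ≥0∞) : EReal) :=
      mul_nonneg hD0 (cz _)
    have : (⊤ : EReal) ≤ ⊤ + limAtZero f * ((Q T : ℝ≥0∞) : EReal)
        + derivAtTop f * ((P.singularPart Q univ : ℝ≥0∞) : EReal) := by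
      calc (⊤ : EReal) = ⊤ + 0 + 0 := by simp
        _ ≤ _ := add_le_add (add_le_add le_rfl t2) t3
    exact le_top.trans this

lemma gs_one {f : ℝ → ℝ} (hV : tvDist P Q = 1) :
    fDiv f P Q = limAtZero f + derivAtTop f := by
  have h1 : ∫ x, min (P.rnDeriv Q x).toReal 1 ∂Q = 0 := by
    have := gs_tv P Q; linarith
  rw [integral_eq_zero_iff_of_nonneg (fun x => le_min ENNReal.toReal_nonneg zero_le_one)
    (gs_int_min P Q)] at h1
  have h2 : ∀ᵐ x ∂Q, P.rnDeriv Q x = 0 := by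
    filter_upwards [h1, Measure.rnDeriv_lt_top P Q] with x hx hx2
    simp only [Pi.zero_apply] at hx
    rcases min_choice (P.rnDeriv Q x).toReal 1 with h | h
    · rw [h] at hx
      exact ((ENNReal.toReal_eq_zero_iff _).1 hx).resolve_right hx2.ne
    · rw [h] at hx; norm_num at hx
  have h3 : Q {x | P.rnDeriv Q x ≠ 0} = 0 := ae_iff.1 h2
  have h4 : Q {x | P.rnDeriv Q x = 0} = 1 := prob_compl_eq_zero_iff
    (Measure.measurable_rnDeriv P Q (measurableSet_singleton 0)) |>.1 h3
  have h5 : P.singularPart Q univ = 1 := by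
    have h6 := gs_mass P Q
    have h7 : ∫ x, (P.rnDeriv Q x).toReal ∂Q = 0 := by
      rw [integral_eq_zero_of_ae]
      filter_upwards [h2] with x hx
      simp [hx]
    rw [h7, zero_add, Measure.real, ENNReal.toReal_eq_one_iff] at h6
    exact h6
  have h8 : Q.restrict {x | P.rnDeriv Q x ≠ 0} = 0 := Measure.restrict_eq_zero.2 h3
  unfold fDiv
  rw [h8, h4, h5]
  simp

end meas

lemma gs_ex_one : ∃ pp : PMPair, tvDist pp.P pp.Q = 1 := by
  refine ⟨⟨Bool, inferInstance, Measure.dirac true, Measure.dirac false, inferInstance,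
    inferInstance⟩, ?_⟩
  show tvDist (Measure.dirac true) (Measure.dirac false) = 1
  rw [gs_tv]
  have : (Measure.dirac true).MutuallySingular (Measure.dirac false) :=
    ⟨{false}, measurableSet_singleton _, by simp, by simp⟩
  have h := this.rnDeriv_ae_eq_zero
  rw [integral_eq_zero_of_ae, sub_zero]
  filter_upwards [h] with x hx
  simp [hx]

lemma gs_ex {f : ℝ → ℝ}
    (hsymm : ∀ x : ℝ, 0 < x → f x = x * f (1 / x)) {V : ℝ} (h0 : 0 ≤ V) (h1 : V < 1) :
    ∃ pp : PMPair, tvDist pp.P pp.Q = V ∧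
      fDiv f pp.P pp.Q = (((1 - V) * f ((1 + V) / (1 - V)) : ℝ) : EReal) := by
  have hV : 0 < 1 - V := by linarith
  set Q : Measure Bool := ENNReal.ofReal ((1 - V) / 2) • Measure.dirac true
    + ENNReal.ofReal ((1 + V) / 2) • Measure.dirac false with hQ
  set r : Bool → ℝ≥0∞ := fun i => if i then ENNReal.ofReal ((1 + V) / (1 - V))
    else ENNReal.ofReal ((1 - V) / (1 + V)) with hr
  have hrm : Measurable r := measurable_from_top
  set P : Measure Bool := Q.withDensity r with hP
  have qQ : IsProbabilityMeasure Q := ⟨by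
    simp only [hQ, Measure.add_apply, Measure.smul_apply, measure_univ, smul_eq_mul, mul_one]
    rw [← ENNReal.ofReal_add (by linarith) (by linarith)]
    rw [ENNReal.ofReal_eq_one]; ring⟩
  have qP : IsProbabilityMeasure P := ⟨by
    rw [hP, withDensity_apply _ MeasurableSet.univ, Measure.restrict_univ, hQ,
      lintegral_add_measure, lintegral_smul_measure, lintegral_smul_measure, lintegral_dirac,
      lintegral_dirac, smul_eq_mul, smul_eq_mul]
    simp only [hr, if_true, Bool.false_eq_true, if_false]
    rw [← ENNReal.ofReal_mul (by linarith), ← ENNReal.ofReal_mul (by linarith),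
      ← ENNReal.ofReal_add (by positivity) (by positivity)]
    rw [ENNReal.ofReal_eq_one]
    have : 1 + V ≠ 0 := by positivity
    field_simp
    ring⟩
  have hint : ∀ g : Bool → ℝ, ∫ x, g x ∂Q = (1 - V) / 2 * g true + (1 + V) / 2 * g false := by
    intro g
    rw [hQ, integral_add_measure, integral_smul_measure, integral_smul_measure, integral_dirac,
      integral_dirac, ENNReal.toReal_ofReal (by linarith), ENNReal.toReal_ofReal (by linarith)]
    · rfl
    · exact (Integrable.of_finite).smul_measure ENNReal.ofReal_ne_top
    · exact (Integrable.of_finite).smul_measure ENNReal.ofReal_ne_top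
  have hae : P.rnDeriv Q =ᵐ[Q] r := Measure.rnDeriv_withDensity Q hrm
  have hrn : P.rnDeriv Q = r := by
    have hz : ∀ i, Q {i} ≠ 0 := by
      intro i
      cases i
      · simp [hQ]; linarith
      · simp [hQ]; linarith
    funext i
    by_contra hne
    have h2 : Q {x | ¬ (P.rnDeriv Q x = r x)} = 0 := ae_iff.1 hae
    exact hz i (measure_mono_null (by simpa using hne) h2)
  have hac : P ≪ Q := withDensity_absolutelyContinuous _ _
  have hrt : (r true).toReal = (1 + V) / (1 - V) := by
    simp only [hr, if_true]; exact ENNReal.toReal_ofReal (by positivity)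
  have hrf : (r false).toReal = (1 - V) / (1 + V) := by
    simp only [hr, Bool.false_eq_true, if_false]; exact ENNReal.toReal_ofReal (by positivity)
  have hp1 : 0 < (1 + V) / (1 - V) := by positivity
  have hp2 : 0 < (1 - V) / (1 + V) := by positivity
  have hne : ∀ x, r x ≠ 0 := by
    intro x h
    cases x
    · rw [h] at hrf; simp only [ENNReal.toReal_zero] at hrf; linarith
    · rw [h] at hrt; simp only [ENNReal.toReal_zero] at hrt; linarith
  refine ⟨⟨Bool, inferInstance, P, Q, qP, qQ⟩, ?_, ?_⟩
  · show tvDist P Q = V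
    rw [gs_tv, hrn, hint, hrt, hrf, min_eq_right, min_eq_left]
    · field_simp; ring
    · rw [div_le_one (by linarith)]; linarith
    · rw [le_div_iff₀ hV]; linarith
  · show fDiv f P Q = _
    unfold fDiv
    rw [hrn]
    have e1 : {x | r x ≠ 0} = univ := by ext x; simpa using hne x
    have e2 : {x | r x = 0} = ∅ := by ext x; simpa using hne x
    rw [e1, e2, Measure.restrict_univ, if_pos Integrable.of_finite, hint, hrt, hrf,
      Measure.singularPart_eq_zero_of_ac hac]
    simp only [measure_empty, Measure.coe_zero, Pi.zero_apply, EReal.coe_ennreal_zero, mul_zero,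
      add_zero]
    congr 1
    have := hsymm _ hp2
    rw [one_div_div] at this
    rw [this]
    field_simp
    ring

/-- **Corollary 2 (Gilardoni, symmetric case).** If `f` is symmetric (`f(x) = x f(1/x)`), then
for every `V ∈ [0,1]` the infimum `B(V)` of `D_f(P‖Q)` subject to `V(P,Q) ≥ V` equals
`(1-V) f((1+V)/(1-V))`; consequently `D_f(P‖Q) ≥ (1-V(P,Q)) f((1+V(P,Q))/(1-V(P,Q)))` for all
`P, Q`, and this inequality is sharp. -/
theorem gilardoni_symmetric (f : ℝ → ℝ)
    (hf : ConvexOn ℝ (Set.Ioi 0) f) (hf1 : f 1 = 0)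
    (hsymm : ∀ x : ℝ, 0 < x → f x = x * f (1 / x)) :
    (∀ V : ℝ, 0 ≤ V → V ≤ 1 →
      sInf {x : EReal | ∃ pp : PMPair, V ≤ tvDist pp.P pp.Q ∧ x = fDiv f pp.P pp.Q} =
        gilBound f V) ∧
    ∀ pp : PMPair, gilBound f (tvDist pp.P pp.Q) ≤ fDiv f pp.P pp.Q := by
  have key : ∀ V : ℝ, 0 ≤ V → V ≤ 1 → ∀ pp : PMPair, V ≤ tvDist pp.P pp.Q →
      gilBound f V ≤ fDiv f pp.P pp.Q := by
    intro V h0 h1 pp hV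
    have := pp.probP
    have := pp.probQ
    unfold gilBound
    split_ifs with h
    · exact gs_lower pp.P pp.Q hf hf1 hsymm h0 h hV
    · exact (gs_one pp.P pp.Q (le_antisymm (gs_tv_le_one _ _) (by linarith))).ge
  refine ⟨fun V h0 h1 => le_antisymm ?_ ?_, fun pp => ?_⟩
  · apply sInf_le
    by_cases h : V < 1
    · obtain ⟨pp, e1, e2⟩ := gs_ex hsymm h0 h
      exact ⟨pp, e1.ge, by rw [e2, gilBound, if_pos h]⟩
    · obtain ⟨pp, e1⟩ := gs_ex_one
      have := pp.probP
      have := pp.probQ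
      exact ⟨pp, by rw [e1]; exact h1, by rw [gs_one _ _ e1, gilBound, if_neg h]⟩
  · apply le_sInf
    rintro x ⟨pp, hV, rfl⟩
    exact key V h0 h1 pp hV
  · have := pp.probP
    have := pp.probQ
    exact key _ (gs_tv_nonneg _ _) (gs_tv_le_one _ _) pp le_rfl

end
end

section
/- Let f(x) := x² − 1 (so D_f is the chi-squared divergence χ²) and let f_1:(0,∞)→ℝ be convex with f_1(1)=0 such that h(x) := (1+f_1(x))/x defines a strictly increasing, strictly convex, twice differentiable bijection of (0,∞) onto (0,∞). Then for every D ≥ 0, A(D) := sup{χ²(P‖Q) : D_{f_1}(P‖Q) ≤ D} (supremum over all pairs of probability measures on all measurable spaces) equals h^{−1}(D+1) − 1, where h^{−1} is the inverse of h on (0,∞). -/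
open MeasureTheory Filter Set
open scoped ENNReal NNReal Classical

noncomputable section

/-- The integrand used in the simplified formula for the divergence. -/
def Fint (f : ℝ → ℝ) (r : ℝ≥0∞) : ℝ := if r = 0 then 0 else f r.toReal + 1

lemma integrable_restrict_iff (f : ℝ → ℝ) {Ω : Type*} [MeasurableSpace Ω] (P Q : Measure Ω)
    [IsProbabilityMeasure Q] :
    Integrable (fun x => f ((Measure.rnDeriv P Q x).toReal))
      (Q.restrict {x | Measure.rnDeriv P Q x ≠ 0}) ↔
    Integrable (fun x => Fint f (Measure.rnDeriv P Q x)) Q := by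
  have hS : MeasurableSet {x | Measure.rnDeriv P Q x ≠ 0} :=
    (Measure.measurable_rnDeriv P Q) (measurableSet_singleton 0).compl
  have e : (fun x => Fint f (Measure.rnDeriv P Q x)) =
      Set.indicator {x | Measure.rnDeriv P Q x ≠ 0}
        (fun x => f ((Measure.rnDeriv P Q x).toReal) + 1) := by
    funext x
    by_cases hx : Measure.rnDeriv P Q x = 0 <;> simp [Fint, hx, Set.indicator]
  rw [e, integrable_indicator_iff hS, IntegrableOn]
  exact (integrable_add_iff_integrable_left (integrable_const (1 : ℝ))).symm

lemma fDiv_eq (f : ℝ → ℝ) (h0 : limAtZero f = -1) {Ω : Type*} [MeasurableSpace Ω]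
    (P Q : Measure Ω) [IsProbabilityMeasure Q] (hs : P.singularPart Q = 0)
    (hi : Integrable (fun x => Fint f (Measure.rnDeriv P Q x)) Q) :
    fDiv f P Q = ((∫ x, Fint f (Measure.rnDeriv P Q x) ∂Q - 1 : ℝ) : EReal) := by
  have hS : MeasurableSet {x | Measure.rnDeriv P Q x ≠ 0} :=
    (Measure.measurable_rnDeriv P Q) (measurableSet_singleton 0).compl
  have e : (fun x => Fint f (Measure.rnDeriv P Q x)) =
      Set.indicator {x | Measure.rnDeriv P Q x ≠ 0}
        (fun x => f ((Measure.rnDeriv P Q x).toReal) + 1) := by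
    funext x
    by_cases hx : Measure.rnDeriv P Q x = 0 <;> simp [Fint, hx, Set.indicator]
  have hi' := (integrable_restrict_iff f P Q).2 hi
  have e2 : (Q {x | Measure.rnDeriv P Q x = 0} : ℝ≥0∞) =
      ENNReal.ofReal (Q.real {x | Measure.rnDeriv P Q x = 0}) := by
    simp
  have e3 : Q.real {x | Measure.rnDeriv P Q x ≠ 0} =
      1 - Q.real {x | Measure.rnDeriv P Q x = 0} := by
    rw [← probReal_compl_eq_one_sub (by
      exact (Measure.measurable_rnDeriv P Q) (measurableSet_singleton 0))]
    rfl
  have e4 : ((Q {x | Measure.rnDeriv P Q x = 0} : ℝ≥0∞) : EReal) =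
      ((Q.real {x | Measure.rnDeriv P Q x = 0} : ℝ) : EReal) := by
    rw [e2, EReal.coe_ennreal_ofReal, max_eq_left measureReal_nonneg]
  unfold fDiv
  rw [if_pos hi', h0, hs, e4, e, integral_indicator hS,
    integral_add hi' (integrable_const _)]
  simp only [Measure.coe_zero, Pi.zero_apply, EReal.coe_ennreal_zero, mul_zero, add_zero,
    integral_const, measureReal_restrict_apply_univ, e3, smul_eq_mul, mul_one]
  rw [show (-1 : EReal) = ((-1 : ℝ) : EReal) by simp, ← EReal.coe_mul, ← EReal.coe_add]
  congr 1
  ring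

lemma limAtZero_of_tendsto (f : ℝ → ℝ)
    (h : Tendsto f (nhdsWithin 0 (Set.Ioi 0)) (nhds (-1))) : limAtZero f = -1 := by
  have := ((continuous_coe_real_ereal.tendsto (-1)).comp h).limsup_eq
  simpa [limAtZero, Function.comp_def] using this

lemma limAtZero_sq : limAtZero (fun t => t ^ 2 - 1) = -1 := by
  apply limAtZero_of_tendsto
  have : Continuous (fun t : ℝ => t ^ 2 - 1) := by fun_prop
  have h := this.tendsto 0
  simp only [ne_eq, OfNat.ofNat_ne_zero, not_false_eq_true, zero_pow, zero_sub] at h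
  exact h.mono_left nhdsWithin_le_nhds

lemma limAtZero_f1 (f1 : ℝ → ℝ) (hf11 : f1 1 = 0)
    (hmono : StrictMonoOn (fun x => (1 + f1 x) / x) (Set.Ioi 0))
    (hbij : Set.BijOn (fun x => (1 + f1 x) / x) (Set.Ioi 0) (Set.Ioi 0)) :
    limAtZero f1 = -1 := by
  apply limAtZero_of_tendsto
  have hid : Tendsto (fun x : ℝ => x - 1) (nhdsWithin 0 (Set.Ioi 0)) (nhds (-1)) := by
    have : Continuous (fun t : ℝ => t - 1) := by fun_prop
    have h := this.tendsto 0
    simp only [zero_sub] at h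
    exact h.mono_left nhdsWithin_le_nhds
  refine tendsto_of_tendsto_of_tendsto_of_le_of_le' tendsto_const_nhds hid ?_ ?_
  · filter_upwards [self_mem_nhdsWithin] with x hx
    have h1 : 0 < (1 + f1 x) / x := hbij.mapsTo hx
    have h2 : (0 : ℝ) < x := hx
    have := (div_pos_iff_of_pos_right h2).1 h1
    linarith
  · have : Set.Ioo (0 : ℝ) 1 ∈ nhdsWithin 0 (Set.Ioi 0) := Ioo_mem_nhdsGT one_pos
    filter_upwards [this] with x hx
    have h1 := hmono (show x ∈ Set.Ioi (0 : ℝ) from hx.1)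
      (Set.mem_Ioi.2 (zero_lt_one' ℝ)) hx.2
    simp only [hf11] at h1
    rw [div_lt_iff₀ hx.1] at h1
    linarith

lemma derivAtTop_f1 (f1 : ℝ → ℝ)
    (hmono : StrictMonoOn (fun x => (1 + f1 x) / x) (Set.Ioi 0))
    (hbij : Set.BijOn (fun x => (1 + f1 x) / x) (Set.Ioi 0) (Set.Ioi 0)) :
    derivAtTop f1 = ⊤ := by
  have h : Tendsto (fun x => f1 x / x) atTop atTop := by
    rw [tendsto_atTop]
    intro b
    obtain ⟨y, hy, hy2⟩ := hbij.surjOn (show |b| + 1 ∈ Set.Ioi (0 : ℝ) from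
      by have := abs_nonneg b; simp only [Set.mem_Ioi]; linarith)
    filter_upwards [eventually_gt_atTop y, eventually_gt_atTop 1] with x hx hx1
    have h0 : (0 : ℝ) < x := by linarith
    have h1 := hmono hy (show x ∈ Set.Ioi (0 : ℝ) from h0) hx
    simp only at h1 hy2
    rw [hy2, add_div] at h1
    have h3 : 1 / x < 1 := by rw [div_lt_one h0]; exact hx1
    have := le_abs_self b
    linarith
  have := (EReal.tendsto_coe_nhds_top_iff.2 h).limsup_eq
  simpa [derivAtTop] using this

/-- Supporting line of `h` at `c`. -/
lemma support_line (h : ℝ → ℝ) (hm : StrictMonoOn h (Set.Ioi 0))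
    (hc : StrictConvexOn ℝ (Set.Ioi 0) h) (hd : ContDiffOn ℝ 2 h (Set.Ioi 0))
    (c : ℝ) (hc0 : 0 < c) : ∃ s : ℝ, 0 < s ∧ ∀ x, 0 < x → h c + s * (x - c) ≤ h x := by
  have hdiff : DifferentiableAt ℝ h c :=
    (hd.differentiableOn (by norm_num)).differentiableAt (Ioi_mem_nhds hc0)
  have hline : ∀ x, 0 < x → h c + deriv h c * (x - c) ≤ h x := by
    intro x hx
    rcases lt_trichotomy x c with hlt | heq | hgt
    · have := hc.convexOn.slope_le_deriv hx hc0 hlt hdiff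
      rw [slope_def_field, div_le_iff₀ (by linarith)] at this
      linarith
    · subst heq; simp
    · have := hc.convexOn.deriv_le_slope hc0 hx hgt hdiff
      rw [slope_def_field, le_div_iff₀ (by linarith)] at this
      linarith
  refine ⟨deriv h c, ?_, hline⟩
  have h2 := hline (c / 2) (by linarith)
  have h3 := hm (show c / 2 ∈ Set.Ioi (0 : ℝ) from half_pos hc0) hc0 (half_lt_self hc0)
  nlinarith

lemma upper (f1 : ℝ → ℝ) (h0 : limAtZero f1 = -1) (ht : derivAtTop f1 = ⊤)
    (D c s : ℝ) (hs : 0 < s)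
    (hline : ∀ x, 0 < x → D + 1 + s * (x - c) ≤ (1 + f1 x) / x)
    {Ω : Type*} [MeasurableSpace Ω]
    (P Q : Measure Ω) [IsProbabilityMeasure P] [IsProbabilityMeasure Q]
    (hD : fDiv f1 P Q ≤ (D : EReal)) :
    fDiv (fun t => t ^ 2 - 1) P Q ≤ ((c - 1 : ℝ) : EReal) := by
  have hm1 : limAtZero f1 * ((Q {x | Measure.rnDeriv P Q x = 0} : ℝ≥0∞) : EReal) ≠ ⊥ := by
    rw [h0, ← ENNReal.ofReal_toReal (measure_ne_top Q {x | Measure.rnDeriv P Q x = 0}),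
      EReal.coe_ennreal_ofReal, show (-1 : EReal) = ((-1 : ℝ) : EReal) by simp, ← EReal.coe_mul]
    exact EReal.coe_ne_bot _
  have hm2 : (0 : EReal) ≤
      derivAtTop f1 * ((Measure.singularPart P Q Set.univ : ℝ≥0∞) : EReal) := by
    rw [ht]
    exact mul_nonneg le_top (EReal.coe_ennreal_nonneg _)
  have hsing : P.singularPart Q = 0 := by
    by_contra hne
    have hpos : (0 : EReal) < ((Measure.singularPart P Q Set.univ : ℝ≥0∞) : EReal) := by
      rw [EReal.coe_ennreal_pos]
      exact pos_iff_ne_zero.2 (fun h => hne (Measure.measure_univ_eq_zero.1 h))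
    unfold fDiv at hD
    rw [ht, EReal.top_mul_of_pos hpos, EReal.add_top_of_ne_bot] at hD
    · exact absurd hD (by simp)
    · rw [Ne, EReal.add_eq_bot_iff, not_or]
      refine ⟨?_, hm1⟩
      split_ifs
      · exact EReal.coe_ne_bot _
      · simp
  have hint : Integrable (fun x => Fint f1 (Measure.rnDeriv P Q x)) Q := by
    rw [← integrable_restrict_iff]
    by_contra hne
    unfold fDiv at hD
    rw [if_neg hne, EReal.top_add_of_ne_bot hm1, EReal.top_add_of_ne_bot
      (ne_of_gt (lt_of_lt_of_le EReal.bot_lt_zero hm2))] at hD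
    exact absurd hD (by simp)
  rw [fDiv_eq f1 h0 P Q hsing hint, EReal.coe_le_coe_iff] at hD
  have hac : P ≪ Q := Measure.singularPart_eq_zero P Q |>.1 hsing
  have hp : Integrable (fun x => (P.rnDeriv Q x).toReal) Q := Measure.integrable_toReal_rnDeriv
  have hp1 : ∫ x, (P.rnDeriv Q x).toReal ∂Q = 1 := by
    rw [Measure.integral_toReal_rnDeriv hac]; simp
  have hFsq : ∀ x, Fint (fun t => t ^ 2 - 1) (P.rnDeriv Q x) = (P.rnDeriv Q x).toReal ^ 2 := by
    intro x
    unfold Fint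
    split_ifs with h
    · simp [h]
    · ring
  have hbd : ∀ᵐ x ∂Q, s * (P.rnDeriv Q x).toReal ^ 2 ≤
      Fint f1 (P.rnDeriv Q x) + (s * c - (D + 1)) * (P.rnDeriv Q x).toReal := by
    filter_upwards [P.rnDeriv_ne_top Q] with x hx
    unfold Fint
    split_ifs with h
    · simp [h]
    · have hpos := ENNReal.toReal_pos h hx
      have := hline _ hpos
      rw [le_div_iff₀ hpos] at this
      nlinarith
  have hI2 : Integrable (fun x => Fint f1 (P.rnDeriv Q x) +
      (s * c - (D + 1)) * (P.rnDeriv Q x).toReal) Q := hint.add (hp.const_mul _)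
  have hI1 : Integrable (fun x => s * (P.rnDeriv Q x).toReal ^ 2) Q := by
    refine hI2.mono' ?_ ?_
    · have := Measure.measurable_rnDeriv P Q
      exact Measurable.aestronglyMeasurable (by fun_prop)
    · filter_upwards [hbd] with x hx
      rwa [Real.norm_of_nonneg (by positivity)]
  have hI0 : Integrable (fun x => (P.rnDeriv Q x).toReal ^ 2) Q :=
    (integrable_const_mul_iff (IsUnit.mk0 s hs.ne') _).1 hI1
  have hle := integral_mono_ae hI1 hI2 hbd
  rw [integral_add hint (hp.const_mul _), integral_const_mul, integral_const_mul, hp1] at hle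
  rw [fDiv_eq _ limAtZero_sq P Q hsing (by simpa only [hFsq] using hI0), EReal.coe_le_coe_iff]
  simp only [hFsq]
  have : s * ∫ x, (P.rnDeriv Q x).toReal ^ 2 ∂Q ≤ s * c := by linarith
  have := le_of_mul_le_mul_left this hs
  linarith

lemma attain (c : ℝ) (hc : 1 ≤ c) : ∃ pp : PMPair, ∀ f : ℝ → ℝ, limAtZero f = -1 →
    fDiv f pp.P pp.Q = (((1 + f c) / c - 1 : ℝ) : EReal) := by
  have hc0 : 0 < c := by linarith
  have hci : 1 / c ≤ 1 := by rw [div_le_one hc0]; exact hc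
  let Q : Measure Bool := ENNReal.ofReal (1 / c) • Measure.dirac true +
    ENNReal.ofReal (1 - 1 / c) • Measure.dirac false
  let u : Bool → ℝ≥0∞ := fun b => if b = true then ENNReal.ofReal c else 0
  have hQ : IsProbabilityMeasure Q := ⟨by
    simp only [Q, Measure.add_apply, Measure.smul_apply, measure_univ, smul_eq_mul, mul_one]
    rw [← ENNReal.ofReal_add (by positivity) (by linarith)]
    simp⟩
  have hu : Measurable u := measurable_from_top
  have hP : IsProbabilityMeasure (Q.withDensity u) := ⟨by
    rw [withDensity_apply _ MeasurableSet.univ, Measure.restrict_univ]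
    simp only [Q, lintegral_add_measure, lintegral_smul_measure, lintegral_dirac, u]
    simp only [if_true, Bool.false_eq_true, if_false, smul_eq_mul, mul_zero, add_zero]
    rw [← ENNReal.ofReal_mul (by positivity), one_div_mul_cancel hc0.ne', ENNReal.ofReal_one]⟩
  refine ⟨⟨Bool, inferInstance, Q.withDensity u, Q, hP, hQ⟩, fun f hf => ?_⟩
  have hr : (Q.withDensity u).rnDeriv Q =ᵐ[Q] u := Measure.rnDeriv_withDensity Q hu
  have hr2 : (fun x => Fint f ((Q.withDensity u).rnDeriv Q x)) =ᵐ[Q] fun x => Fint f (u x) := by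
    filter_upwards [hr] with x hx
    rw [hx]
  have hsing : (Q.withDensity u).singularPart Q = 0 :=
    (Measure.singularPart_eq_zero _ _).2 (withDensity_absolutelyContinuous Q u)
  have hi : Integrable (fun x => Fint f (u x)) Q := Integrable.of_finite
  have key := fDiv_eq f hf (Q.withDensity u) Q hsing (hi.congr hr2.symm)
  simp only
  rw [key, integral_congr_ae hr2]
  congr 2
  have hne : ENNReal.ofReal c ≠ 0 := by simpa using hc0
  rw [integral_add_measure (Integrable.of_finite.smul_measure ENNReal.ofReal_ne_top)
      (Integrable.of_finite.smul_measure ENNReal.ofReal_ne_top), integral_smul_measure,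
    integral_smul_measure, integral_dirac, integral_dirac]
  simp only [u, Fint, if_true, Bool.false_eq_true, if_false, hne, smul_zero, add_zero]
  rw [ENNReal.toReal_ofReal hc0.le, ENNReal.toReal_ofReal (by positivity), smul_eq_mul]
  field_simp
  ring

/-- **Theorem 6 (chi-squared divergence).** If `h(x) = (1 + f_1(x))/x` is a strictly
increasing, strictly convex, twice differentiable bijection of `(0,∞)` onto itself, then the
supremum of `χ²(P‖Q)` subject to `D_{f_1}(P‖Q) ≤ D` equals `h⁻¹(D+1) - 1`. -/
theorem sup_chiSq_constraint (f1 : ℝ → ℝ)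
    (hf1conv : ConvexOn ℝ (Set.Ioi 0) f1) (hf11 : f1 1 = 0)
    (hmono : StrictMonoOn (fun x => (1 + f1 x) / x) (Set.Ioi 0))
    (hconv : StrictConvexOn ℝ (Set.Ioi 0) fun x => (1 + f1 x) / x)
    (hsmooth : ContDiffOn ℝ 2 (fun x => (1 + f1 x) / x) (Set.Ioi 0))
    (hbij : Set.BijOn (fun x => (1 + f1 x) / x) (Set.Ioi 0) (Set.Ioi 0))
    (g : ℝ → ℝ) (hg : ∀ x ∈ Set.Ioi (0 : ℝ), g ((1 + f1 x) / x) = x)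
    (hg' : ∀ y ∈ Set.Ioi (0 : ℝ), (1 + f1 (g y)) / g y = y)
    (D : ℝ) (hD : 0 ≤ D) :
    sSup {x : EReal | ∃ pp : PMPair,
        fDiv f1 pp.P pp.Q ≤ (D : EReal) ∧
        x = fDiv (fun t => t ^ 2 - 1) pp.P pp.Q} = ((g (D + 1) - 1 : ℝ) : EReal) := by
  have h0 := limAtZero_f1 f1 hf11 hmono hbij
  have ht := derivAtTop_f1 f1 hmono hbij
  obtain ⟨y, hy, hyD⟩ := hbij.surjOn (show D + 1 ∈ Set.Ioi (0 : ℝ) from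
    by simp only [Set.mem_Ioi]; linarith)
  simp only at hyD
  have hgy : g (D + 1) = y := by rw [← hyD]; exact hg y hy
  rw [hgy]
  have hy1 : 1 ≤ y := by
    by_contra hlt
    have := hmono hy (Set.mem_Ioi.2 (zero_lt_one' ℝ)) (not_le.1 hlt)
    simp only [hyD, hf11] at this
    norm_num at this
    linarith
  have hy0 : 0 < y := hy
  obtain ⟨s, hs, hline⟩ := support_line _ hmono hconv hsmooth y hy0
  simp only [hyD] at hline
  apply le_antisymm
  · apply sSup_le
    rintro _ ⟨pp, hpp, rfl⟩
    have := pp.probP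
    have := pp.probQ
    exact upper f1 h0 ht D y s hs hline pp.P pp.Q hpp
  · obtain ⟨pp, hpp⟩ := attain y hy1
    apply le_sSup
    refine ⟨pp, ?_, ?_⟩
    · rw [hpp f1 h0, hyD]
      simp
    · rw [hpp _ limAtZero_sq]
      congr 1
      field_simp
      ring

end
end

section
/- Fix l > 2 and let D^{(l)} denote the power divergence, the f-divergence with f_1(x) = x^l − 1. Then sup{χ²(P‖Q) : D^{(l)}(P‖Q) ≤ D} = (1+D)^{1/(l−1)} − 1 for every D ≥ 0, the supremum over all pairs of probability measures on all measurable spaces. Equivalently, for every pair of probability measures P and Q, χ²(P‖Q) + 1 ≤ (1 + D^{(l)}(P‖Q))^{1/(l−1)}, and this inequality is sharp. -/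
open MeasureTheory Filter Set
open scoped ENNReal NNReal Classical

noncomputable section

theorem ennreal_coe_aux (a : ℝ≥0∞) (ha : a ≠ ⊤) : (a : EReal) = ((a.toReal : ℝ) : EReal) := by
  lift a to ℝ≥0 using ha
  rfl

theorem limAtZero_pow (l : ℝ) (hl : 1 < l) : limAtZero (fun t => t ^ l - 1) = ((-1 : ℝ) : EReal) := by
  unfold limAtZero
  apply Filter.Tendsto.limsup_eq
  rw [EReal.tendsto_coe]
  have h : ContinuousAt (fun t : ℝ => t ^ l - 1) 0 :=
    (Real.continuousAt_rpow_const 0 l (Or.inr (by linarith))).sub continuousAt_const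
  have h2 := h.tendsto
  simp only [Real.zero_rpow (by linarith : l ≠ 0), zero_sub] at h2
  exact h2.mono_left nhdsWithin_le_nhds

theorem derivAtTop_pow (l : ℝ) (hl : 1 < l) : derivAtTop (fun t => t ^ l - 1) = ⊤ := by
  unfold derivAtTop
  apply Filter.Tendsto.limsup_eq
  rw [EReal.tendsto_coe_nhds_top_iff]
  have h1 : Tendsto (fun x : ℝ => x ^ (l - 1) + (-1)) atTop atTop :=
    tendsto_atTop_add_const_right _ _ (tendsto_rpow_atTop (by linarith))
  refine tendsto_atTop_mono' _ ?_ h1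
  filter_upwards [eventually_ge_atTop (1 : ℝ)] with x hx
  have hx0 : 0 < x := by linarith
  rw [Real.rpow_sub_one hx0.ne', sub_div]
  have : 1 / x ≤ 1 := by rw [div_le_one hx0]; exact hx
  linarith

theorem fDiv_pow_eq {Ω : Type*} [MeasurableSpace Ω] (P Q : Measure Ω) [IsProbabilityMeasure P]
    [IsProbabilityMeasure Q] (l : ℝ) (hl : 1 < l) (hPQ : P ≪ Q)
    (hi : Integrable (fun x => (P.rnDeriv Q x).toReal ^ l) Q) :
    fDiv (fun t => t ^ l - 1) P Q = ((∫ x, (P.rnDeriv Q x).toReal ^ l ∂Q - 1 : ℝ) : EReal) := by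
  have hm : MeasurableSet {x | P.rnDeriv Q x = 0} :=
    (Measure.measurable_rnDeriv P Q) (measurableSet_singleton 0)
  have hc : {x | P.rnDeriv Q x ≠ 0} = {x | P.rnDeriv Q x = 0}ᶜ := rfl
  have hi1 : Integrable (fun x => (P.rnDeriv Q x).toReal ^ l - 1) Q :=
    hi.sub (integrable_const 1)
  unfold fDiv
  have hi2 : Integrable (fun x => (P.rnDeriv Q x).toReal ^ l - 1)
      (Q.restrict {x | P.rnDeriv Q x ≠ 0}) := hi1.integrableOn
  beta_reduce
  rw [if_pos hi2, limAtZero_pow l hl, Measure.singularPart_eq_zero_of_ac hPQ]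
  have e1 : ((Q {x | P.rnDeriv Q x = 0} : ℝ≥0∞) : EReal)
      = ((Q.real {x | P.rnDeriv Q x = 0} : ℝ) : EReal) := by
    exact ennreal_coe_aux _ (measure_ne_top Q _)
  rw [e1]
  simp only [Measure.coe_zero, Pi.zero_apply, EReal.coe_ennreal_zero, mul_zero, add_zero]
  rw [← EReal.coe_mul, ← EReal.coe_add]
  congr 1
  have h2 := integral_add_compl hm hi1
  have h3 : ∫ x in {x | P.rnDeriv Q x = 0}, ((P.rnDeriv Q x).toReal ^ l - 1) ∂Q
      = -Q.real {x | P.rnDeriv Q x = 0} := by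
    rw [setIntegral_congr_fun (g := fun _ => (-1 : ℝ)) hm]
    · simp
    · intro x hx
      have hx' : P.rnDeriv Q x = 0 := hx
      simp [hx', Real.zero_rpow (by linarith : l ≠ 0)]
  have h4 : ∫ x, ((P.rnDeriv Q x).toReal ^ l - 1) ∂Q
      = ∫ x, (P.rnDeriv Q x).toReal ^ l ∂Q - 1 := by
    rw [integral_sub hi (integrable_const 1)]; simp
  rw [hc]
  linarith

theorem fDiv_pow_fin {Ω : Type*} [MeasurableSpace Ω] (P Q : Measure Ω) [IsProbabilityMeasure P]
    [IsProbabilityMeasure Q] (l : ℝ) (hl : 1 < l) (d : ℝ)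
    (h : fDiv (fun t => t ^ l - 1) P Q ≤ (d : EReal)) :
    P ≪ Q ∧ Integrable (fun x => (P.rnDeriv Q x).toReal ^ l) Q := by
  have hm : MeasurableSet {x | P.rnDeriv Q x = 0} :=
    (Measure.measurable_rnDeriv P Q) (measurableSet_singleton 0)
  have hc : {x | P.rnDeriv Q x ≠ 0} = {x | P.rnDeriv Q x = 0}ᶜ := rfl
  unfold fDiv at h
  rw [limAtZero_pow l hl, derivAtTop_pow l hl] at h
  have e1 : ((Q {x | P.rnDeriv Q x = 0} : ℝ≥0∞) : EReal)
      = ((Q.real {x | P.rnDeriv Q x = 0} : ℝ) : EReal) := by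
    exact ennreal_coe_aux _ (measure_ne_top Q _)
  rw [e1, ← EReal.coe_mul] at h
  have hs : P.singularPart Q univ = 0 := by
    by_contra hne
    have hpos : (0 : EReal) < ((P.singularPart Q univ : ℝ≥0∞) : EReal) := by
      rw [EReal.coe_ennreal_pos]; exact pos_iff_ne_zero.2 hne
    rw [EReal.top_mul_of_pos hpos] at h
    rw [EReal.add_top_of_ne_bot] at h
    · exact absurd h (not_le.2 (EReal.coe_lt_top d))
    · split_ifs
      · rw [← EReal.coe_add]; exact EReal.coe_ne_bot _
      · rw [EReal.top_add_coe]; simp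
  rw [hs] at h
  simp only [EReal.coe_ennreal_zero, mul_zero, add_zero] at h
  have hac : P ≪ Q := by
    rw [← Measure.singularPart_eq_zero]
    exact Measure.measure_univ_eq_zero.1 hs
  refine ⟨hac, ?_⟩
  split_ifs at h with hint
  · have h1 : IntegrableOn (fun x => (P.rnDeriv Q x).toReal ^ l - 1) {x | P.rnDeriv Q x = 0} Q := by
      refine IntegrableOn.congr_fun (f := fun _ => (-1 : ℝ)) (integrable_const _) ?_ hm
      intro x hx
      have hx' : P.rnDeriv Q x = 0 := hx
      simp [hx', Real.zero_rpow (by linarith : l ≠ 0)]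
    have h2 : Integrable (fun x => (P.rnDeriv Q x).toReal ^ l - 1) Q := by
      rw [← integrableOn_univ, ← union_compl_self {x | P.rnDeriv Q x = 0}]
      exact h1.union hint
    have h3 := h2.add (integrable_const (1 : ℝ))
    refine h3.congr (ae_of_all _ fun x => ?_)
    simp
  · rw [EReal.top_add_coe] at h
    exact absurd h (not_le.2 (EReal.coe_lt_top d))

theorem pow_tangent (l : ℝ) (hl : 2 < l) (r M : ℝ) (hr : 0 ≤ r) (hM : 0 < M) :
    (l - 1) * M ^ (l - 2) * r ^ 2 - (l - 2) * M ^ (l - 1) * r ≤ r ^ l := by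
  rcases hr.eq_or_lt with rfl | hr
  · simp [Real.zero_rpow (by linarith : l ≠ 0)]
  have h := one_add_mul_self_le_rpow_one_add (s := r / M - 1) (by
    have : 0 ≤ r / M := by positivity
    linarith) (p := l - 1) (by linarith)
  have e : 1 + (r / M - 1) = r / M := by ring
  rw [e, Real.div_rpow hr.le hM.le] at h
  have hp : 0 < M ^ (l - 1) := by positivity
  rw [le_div_iff₀ hp] at h
  have e2 : M ^ (l - 1) = M ^ (l - 2) * M := by
    rw [← Real.rpow_add_one hM.ne']; congr 1; ring
  have e3 : r ^ l = r ^ (l - 1) * r := by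
    rw [← Real.rpow_add_one hr.ne']; congr 1; ring
  rw [e3]
  have h2 := mul_le_mul_of_nonneg_right h hr.le
  refine le_trans (le_of_eq ?_) h2
  rw [e2]
  field_simp
  ring

theorem chi_bound {Ω : Type*} [MeasurableSpace Ω] (P Q : Measure Ω) [IsProbabilityMeasure P]
    [IsProbabilityMeasure Q] (l : ℝ) (hl : 2 < l) (d : ℝ) (hd : 0 ≤ d)
    (h : fDiv (fun t => t ^ l - 1) P Q ≤ (d : EReal)) :
    ∃ m : ℝ, fDiv (fun t => t ^ (2 : ℕ) - 1) P Q = ((m - 1 : ℝ) : EReal) ∧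
      m ≤ (1 + d) ^ (1 / (l - 1)) := by
  obtain ⟨hac, hi⟩ := fDiv_pow_fin P Q l (by linarith) d h
  rw [fDiv_pow_eq P Q l (by linarith) hac hi, EReal.coe_le_coe_iff] at h
  have hr1 : Integrable (fun x => (P.rnDeriv Q x).toReal) Q := Measure.integrable_toReal_rnDeriv
  have hI1 : ∫ x, (P.rnDeriv Q x).toReal ∂Q = 1 := by
    rw [Measure.integral_toReal_rnDeriv hac]; simp
  have hmeas : Measurable (fun x => (P.rnDeriv Q x).toReal) :=
    (Measure.measurable_rnDeriv P Q).ennreal_toReal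
  have hi2 : Integrable (fun x => (P.rnDeriv Q x).toReal ^ 2) Q := by
    refine ((integrable_const (1 : ℝ)).add hi).mono' (hmeas.pow_const 2).aestronglyMeasurable ?_
    refine ae_of_all _ fun x => ?_
    have hr : 0 ≤ (P.rnDeriv Q x).toReal := ENNReal.toReal_nonneg
    rw [Real.norm_of_nonneg (by positivity)]
    simp only [Pi.add_apply]
    rcases le_total (P.rnDeriv Q x).toReal 1 with h1 | h1
    · have := Real.rpow_nonneg hr l
      nlinarith
    · have := Real.rpow_le_rpow_of_exponent_le h1 hl.le
      rw [Real.rpow_two] at this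
      linarith
  set m := ∫ x, (P.rnDeriv Q x).toReal ^ 2 ∂Q with hmdef
  have hfe : (fun t : ℝ => t ^ (2 : ℕ) - 1) = fun t : ℝ => t ^ (2 : ℝ) - 1 := by
    funext t; rw [Real.rpow_two]
  refine ⟨m, ?_, ?_⟩
  · rw [hfe, fDiv_pow_eq P Q 2 (by norm_num) hac (by simpa only [Real.rpow_two] using hi2)]
    simp only [Real.rpow_two, hmdef]
  have hm1 : 1 ≤ m := by
    have : ∫ x, (2 * (P.rnDeriv Q x).toReal - 1) ∂Q ≤ m := by
      apply integral_mono ((hr1.const_mul 2).sub (integrable_const 1)) hi2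
      intro x
      change 2 * (P.rnDeriv Q x).toReal - 1 ≤ (P.rnDeriv Q x).toReal ^ 2
      nlinarith [sq_nonneg ((P.rnDeriv Q x).toReal - 1)]
    rw [integral_sub (hr1.const_mul 2) (integrable_const 1), integral_const_mul, hI1] at this
    simp at this
    linarith
  have hm0 : 0 < m := by linarith
  have key : m ^ (l - 1) ≤ 1 + d := by
    have h5 : ∫ x, ((l - 1) * m ^ (l - 2) * (P.rnDeriv Q x).toReal ^ 2
        - (l - 2) * m ^ (l - 1) * (P.rnDeriv Q x).toReal) ∂Q
        ≤ ∫ x, (P.rnDeriv Q x).toReal ^ l ∂Q := by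
      apply integral_mono ((hi2.const_mul _).sub (hr1.const_mul _)) hi
      intro x
      exact pow_tangent l hl _ m ENNReal.toReal_nonneg hm0
    rw [integral_sub (hi2.const_mul _) (hr1.const_mul _), integral_const_mul,
      integral_const_mul, hI1, ← hmdef] at h5
    have e2 : m ^ (l - 1) = m ^ (l - 2) * m := by
      rw [← Real.rpow_add_one hm0.ne']; congr 1; ring
    rw [e2] at h5 ⊢
    linarith
  calc m = (m ^ (l - 1)) ^ (1 / (l - 1)) := by
        rw [← Real.rpow_mul hm0.le, mul_one_div_cancel (by linarith), Real.rpow_one]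
    _ ≤ _ := Real.rpow_le_rpow (by positivity) key (by
        apply div_nonneg <;> linarith)

theorem example_pair (M : ℝ) (hM : 1 ≤ M) : ∃ pp : PMPair, ∀ k : ℝ, 1 < k →
    fDiv (fun t => t ^ k - 1) pp.P pp.Q = ((M ^ (k - 1) - 1 : ℝ) : EReal) := by
  have hM0 : 0 < M := by linarith
  have hMi : 1 / M ≤ 1 := by rw [div_le_one hM0]; exact hM
  have hMi0 : 0 ≤ 1 / M := by positivity
  let Q : Measure Bool := ENNReal.ofReal (1 / M) • Measure.dirac true
    + ENNReal.ofReal (1 - 1 / M) • Measure.dirac false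
  let g : Bool → ℝ≥0∞ := fun b => if b then ENNReal.ofReal M else 0
  have hg : Measurable g := measurable_of_countable _
  let P : Measure Bool := Q.withDensity g
  have hQ : IsProbabilityMeasure Q := ⟨by
    simp only [Q, Measure.add_apply, Measure.smul_apply, measure_univ, smul_eq_mul, mul_one]
    rw [← ENNReal.ofReal_add hMi0 (by linarith)]; simp⟩
  have hP : IsProbabilityMeasure P := ⟨by
    simp only [P, Q, withDensity_apply _ MeasurableSet.univ, Measure.restrict_univ,
      lintegral_add_measure, lintegral_smul_measure, lintegral_dirac, g]
    simp only [smul_eq_mul, if_true, Bool.false_eq_true, if_false, mul_zero, add_zero]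
    rw [← ENNReal.ofReal_mul hMi0, one_div_mul_cancel hM0.ne', ENNReal.ofReal_one]⟩
  refine ⟨⟨Bool, inferInstance, P, Q, hP, hQ⟩, fun k hk => ?_⟩
  have hae : P.rnDeriv Q =ᵐ[Q] g := Measure.rnDeriv_withDensity Q hg
  have hae' : (fun x => (g x).toReal ^ k) =ᵐ[Q] fun x => (P.rnDeriv Q x).toReal ^ k := by
    filter_upwards [hae] with x hx
    rw [hx]
  have hgi : Integrable (fun x => (g x).toReal ^ k) Q := Integrable.of_finite
  change fDiv (fun t => t ^ k - 1) P Q = _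
  rw [fDiv_pow_eq P Q k hk (withDensity_absolutelyContinuous _ _) (hgi.congr hae'),
    ← integral_congr_ae hae']
  congr 2
  have f1 : IsFiniteMeasure (ENNReal.ofReal (1 / M) • Measure.dirac true) :=
    Measure.smul_finite _ ENNReal.ofReal_ne_top
  have f2 : IsFiniteMeasure (ENNReal.ofReal (1 - 1 / M) • Measure.dirac false) :=
    Measure.smul_finite _ ENNReal.ofReal_ne_top
  simp only [Q]
  rw [integral_add_measure Integrable.of_finite Integrable.of_finite,
    integral_smul_measure, integral_smul_measure, integral_dirac, integral_dirac]
  simp only [g, if_true, Bool.false_eq_true, if_false, ENNReal.toReal_zero,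
    Real.zero_rpow (by linarith : k ≠ 0), smul_zero, add_zero, ENNReal.toReal_ofReal hM0.le,
    ENNReal.toReal_ofReal hMi0, smul_eq_mul]
  rw [Real.rpow_sub_one hM0.ne']
  ring

/-- **Corollary 3.** For the power divergence `D^{(l)}` with `f_1(x) = x^l - 1`, `l > 2`, the
supremum of `χ²(P‖Q)` subject to `D^{(l)}(P‖Q) ≤ D` equals `(1+D)^{1/(l-1)} - 1`; equivalently
the sharp inequality `χ²(P‖Q) + 1 ≤ (1 + D^{(l)}(P‖Q))^{1/(l-1)}` holds. -/
theorem sup_chiSq_power_constraint (l : ℝ) (hl : 2 < l) (D : ℝ) (hD : 0 ≤ D) :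
    sSup {x : EReal | ∃ pp : PMPair,
        fDiv (fun t => t ^ l - 1) pp.P pp.Q ≤ (D : EReal) ∧
        x = fDiv (fun t => t ^ (2 : ℕ) - 1) pp.P pp.Q}
      = (((1 + D) ^ (1 / (l - 1)) - 1 : ℝ) : EReal) ∧
    ∀ pp : PMPair, ∀ d : ℝ, 0 ≤ d →
      fDiv (fun t => t ^ l - 1) pp.P pp.Q ≤ (d : EReal) →
      fDiv (fun t => t ^ (2 : ℕ) - 1) pp.P pp.Q + 1
        ≤ (((1 + d) ^ (1 / (l - 1)) : ℝ) : EReal) := by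
  refine ⟨?_, ?_⟩
  · apply le_antisymm
    · apply sSup_le
      rintro x ⟨pp, h1, rfl⟩
      have := pp.probP
      have := pp.probQ
      obtain ⟨m, hm, hle⟩ := chi_bound pp.P pp.Q l hl D hD h1
      rw [hm, EReal.coe_le_coe_iff]
      linarith
    · have hM : 1 ≤ (1 + D) ^ (1 / (l - 1)) :=
        Real.one_le_rpow (by linarith) (div_nonneg (by norm_num) (by linarith))
      obtain ⟨pp, hpp⟩ := example_pair _ hM
      apply le_sSup
      refine ⟨pp, ?_, ?_⟩
      · rw [hpp l (by linarith), ← Real.rpow_mul (by linarith),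
          one_div_mul_cancel (by linarith), Real.rpow_one]
        rw [EReal.coe_le_coe_iff]; linarith
      · have h2 := hpp 2 (by norm_num)
        simp only [Real.rpow_two] at h2
        rw [h2]
        norm_num
  · intro pp d hd h
    have := pp.probP
    have := pp.probQ
    obtain ⟨m, hm, hle⟩ := chi_bound pp.P pp.Q l hl d hd h
    rw [hm]
    have : (1 : EReal) = ((1 : ℝ) : EReal) := rfl
    rw [this, ← EReal.coe_add, EReal.coe_le_coe_iff]
    linarith

end
end
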